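/- arXiv:1909.04460 — 3 statements merged into one kernel-verified Lean document; each statement's English description precedes it below -/
import Mathlib

section
/- For every integer r ≥ 1 and every 0 ≤ j ≤ r, the rational number f_j(r) is a nonnegative integer. -/
open Finset

/-- `f j (r) = (1/r) Σ_{d | gcd(r,j)} μ(d) (−1)^{j+j/d} C(r/d, j/d)` as a rational number. -/
def f (r j : ℕ) : ℚ :=
  (1 / (r : ℚ)) * ∑ d ∈ (Nat.gcd r j).divisors,
    ((ArithmeticFunction.moebius d : ℤ) : ℚ) * (-1) ^ (j + j / d) *
      ((r / d).choose (j / d) : ℚ)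

/-- A finite group acting freely on a type has cardinality dividing that of the type. -/
theorem card_dvd_card_of_free {G X : Type*} [Group G] [MulAction G X]
    (h : ∀ x : X, MulAction.stabilizer G x = ⊥) : Nat.card G ∣ Nat.card X := by
  rw [Nat.card_congr (MulAction.selfEquivOrbitsQuotientProd h), Nat.card_prod]
  exact dvd_mul_left _ _

open scoped Pointwise in
/-- The finite subsets of size `j` with trivial stabilizer come in free orbits. -/
theorem card_dvd_card_trivial_stabilizer (G : Type*) [CommGroup G] [DecidableEq G] (j : ℕ) :
    Nat.card G ∣ Nat.card {S : Finset G // #S = j ∧ MulAction.stabilizer G S = ⊥} := by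
  let Y : SubMulAction G (Finset G) :=
    { carrier := {S | #S = j ∧ MulAction.stabilizer G S = ⊥}
      smul_mem' := by
        rintro g S ⟨hS, hs⟩
        refine ⟨by rw [Finset.card_smul_finset, hS], ?_⟩
        rw [MulAction.stabilizer_smul_eq_stabilizer_map_conj, hs, Subgroup.map_bot] }
  refine card_dvd_card_of_free (G := G) (X := Y) fun x => ?_
  rw [SubMulAction.stabilizer_of_subMul]
  exact x.2.2

open scoped Pointwise in
/-- The finite subsets invariant under a subgroup `H` correspond to subsets of the quotient. -/
theorem card_invariant_eq_card_quotient {G : Type*} [CommGroup G] [Fintype G] [DecidableEq G]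
    (H : Subgroup G) [Fintype (G ⧸ H)] [DecidableEq (G ⧸ H)]
    [DecidablePred fun S : Finset G => H ≤ MulAction.stabilizer G S] (j : ℕ) :
    #{S : Finset G | #S = j ∧ H ≤ MulAction.stabilizer G S} =
      #{T : Finset (G ⧸ H) | Nat.card H * #T = j} := by
  have hcard (T : Finset (G ⧸ H)) :
      #{g : G | (g : G ⧸ H) ∈ T} = Nat.card H * #T := by
    have := QuotientGroup.card_preimage_mk H (T : Set (G ⧸ H))
    rw [Nat.card_coe_set_eq, Nat.card_coe_set_eq, Set.ncard_coe_finset] at this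
    rw [← this, ← Set.ncard_coe_finset]
    congr 1
    ext g
    simp
  symm
  refine Finset.card_bij (fun T _ => ({g : G | (g : G ⧸ H) ∈ T} : Finset G)) ?_ ?_ ?_
  · intro T hT
    simp only [Finset.mem_filter, Finset.mem_univ, true_and] at hT ⊢
    refine ⟨(hcard T).trans hT, fun h hh => ?_⟩
    rw [MulAction.mem_stabilizer_iff]
    ext g
    rw [← Finset.inv_smul_mem_iff]
    have : ((h⁻¹ • g : G) : G ⧸ H) = g := by
      rw [QuotientGroup.eq]
      simpa [mul_comm] using hh
    simp only [Finset.mem_filter, Finset.mem_univ, true_and, this]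
  · intro T _ T' _ h
    ext q
    obtain ⟨g, rfl⟩ := QuotientGroup.mk_surjective q
    simpa using Finset.ext_iff.1 h g
  · intro S hS
    simp only [Finset.mem_filter, Finset.mem_univ, true_and] at hS
    have himage : ({g : G | (g : G ⧸ H) ∈ S.image ((↑) : G → G ⧸ H)} : Finset G) = S := by
      ext g
      simp only [Finset.mem_filter, Finset.mem_univ, true_and, Finset.mem_image]
      refine ⟨?_, fun hg => ⟨g, hg, rfl⟩⟩
      rintro ⟨s, hs, hsg⟩
      have hmem := Finset.smul_mem_smul_finset (a := s⁻¹ * g) hs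
      rw [MulAction.mem_stabilizer_iff.1 (hS.2 (QuotientGroup.eq.1 hsg))] at hmem
      simpa [mul_comm] using hmem
    refine ⟨S.image (↑), ?_, himage⟩
    simp only [Finset.mem_filter, Finset.mem_univ, true_and]
    rw [← hcard, himage, hS.1]

/-- In a finite cyclic group, the kernel of the `d`-th power map is the smallest subgroup whose
order is divisible by `d`. -/
theorem powMonoidHom_ker_le_iff {G : Type*} [CommGroup G] [IsCyclic G] [Finite G] {d : ℕ}
    (hd : d ∣ Nat.card G) (K : Subgroup G) :
    (powMonoidHom d : G →* G).ker ≤ K ↔ d ∣ Nat.card K := by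
  have hker : Nat.card (powMonoidHom d : G →* G).ker = d := by
    rw [IsCyclic.card_powMonoidHom_ker, Nat.gcd_eq_right hd]
  refine ⟨fun h => hker ▸ Subgroup.card_dvd_of_le h, fun h => ?_⟩
  have hle : (powMonoidHom d : K →* K).ker.map K.subtype ≤ (powMonoidHom d : G →* G).ker := by
    rintro _ ⟨x, hx, rfl⟩
    simpa [MonoidHom.mem_ker, Subtype.ext_iff] using hx
  have heq := Subgroup.eq_of_le_of_card_ge hle (by
    rw [hker, Subgroup.card_map_of_injective K.subtype_injective,
      IsCyclic.card_powMonoidHom_ker, Nat.gcd_eq_right h])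
  exact heq ▸ Subgroup.map_subtype_le _

theorem sum_divisors_moebius (n : ℕ) :
    ∑ d ∈ n.divisors, ArithmeticFunction.moebius d = if n = 1 then 1 else 0 := by
  rw [← ArithmeticFunction.coe_mul_zeta_apply, ArithmeticFunction.moebius_mul_coe_zeta,
    ArithmeticFunction.one_apply]

/-- The Möbius sum counting the primitive binary words of length `r` and weight `j`. -/
def primitiveSum (r j : ℕ) : ℤ :=
  ∑ d ∈ (Nat.gcd r j).divisors, ArithmeticFunction.moebius d * ((r / d).choose (j / d) : ℤ)

open scoped Pointwise in
theorem primitiveSum_eq_card (G : Type*) [CommGroup G] [IsCyclic G] [Finite G] [DecidableEq G]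
    (j : ℕ) : primitiveSum (Nat.card G) j =
      Nat.card {S : Finset G // #S = j ∧ MulAction.stabilizer G S = ⊥} := by
  classical
  have := Fintype.ofFinite G
  have hr : Nat.card G ≠ 0 := Nat.card_pos.ne'
  have hcount : ∀ d ∈ (Nat.card G).divisors,
      #{S : Finset G | #S = j ∧ d ∣ Nat.card (MulAction.stabilizer G S)} =
        if d ∣ j then (Nat.card G / d).choose (j / d) else 0 := by
    intro d hd
    have hdG := Nat.dvd_of_mem_divisors hd
    have hd0 : 0 < d := Nat.pos_of_mem_divisors hd
    have hker : Nat.card (powMonoidHom d : G →* G).ker = d := by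
      rw [IsCyclic.card_powMonoidHom_ker, Nat.gcd_eq_right hdG]
    simp_rw [← powMonoidHom_ker_le_iff hdG]
    rw [card_invariant_eq_card_quotient, hker]
    split_ifs with hj
    · obtain ⟨k, rfl⟩ := hj
      have hq : Fintype.card (G ⧸ (powMonoidHom d : G →* G).ker) = Nat.card G / d := by
        rw [← Nat.card_eq_fintype_card]
        change Subgroup.index _ = _
        rw [IsCyclic.index_powMonoidHom_ker, Nat.gcd_eq_right hdG]
      rw [Nat.mul_div_cancel_left _ hd0, ← hq, ← Finset.card_univ, ← Finset.card_powersetCard]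
      congr 1
      ext T
      simp [hd0.ne']
    · rw [Finset.card_eq_zero, Finset.filter_eq_empty_iff]
      exact fun T _ h => hj ⟨_, h.symm⟩
  have hdiv : (Nat.gcd (Nat.card G) j).divisors = {d ∈ (Nat.card G).divisors | d ∣ j} := by
    ext d
    simp [Nat.dvd_gcd_iff]
  calc primitiveSum (Nat.card G) j
      = ∑ d ∈ (Nat.card G).divisors, ArithmeticFunction.moebius d *
          (#{S : Finset G | #S = j ∧ d ∣ Nat.card (MulAction.stabilizer G S)} : ℤ) := by
        rw [primitiveSum, hdiv, Finset.sum_filter]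
        refine Finset.sum_congr rfl fun d hd => ?_
        rw [hcount d hd]
        split_ifs <;> simp
    _ = ∑ S : Finset G with #S = j, ∑ d ∈ (Nat.card (MulAction.stabilizer G S)).divisors,
          ArithmeticFunction.moebius d := by
        simp_rw [← Finset.filter_filter, Finset.card_filter _ (Finset.filter _ _)]
        push_cast
        simp_rw [Finset.mul_sum]
        rw [Finset.sum_comm]
        refine Finset.sum_congr rfl fun S _ => ?_
        simp only [mul_ite, mul_one, mul_zero]
        rw [← Finset.sum_filter]
        refine Finset.sum_congr ?_ fun _ _ => rfl
        ext d
        have := Subgroup.card_subgroup_dvd_card (MulAction.stabilizer G S)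
        simp only [Finset.mem_filter, Nat.mem_divisors]
        exact ⟨fun h => ⟨h.2, Nat.card_pos.ne'⟩, fun h => ⟨⟨h.1.trans this, hr⟩, h.1⟩⟩
    _ = _ := by
        simp_rw [sum_divisors_moebius, Subgroup.card_eq_one]
        rw [Nat.card_eq_fintype_card, Fintype.card_subtype, ← Finset.filter_filter,
          Finset.card_filter _ (Finset.filter _ _)]
        push_cast
        rfl

theorem primitiveSum_nonneg {r : ℕ} (hr : r ≠ 0) (j : ℕ) : 0 ≤ primitiveSum r j := by
  have : NeZero r := ⟨hr⟩
  have h := primitiveSum_eq_card (Multiplicative (ZMod r)) j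
  simp only [Nat.card_congr Multiplicative.toAdd, Nat.card_zmod] at h
  rw [h]
  positivity

theorem dvd_primitiveSum {r : ℕ} (hr : r ≠ 0) (j : ℕ) : (r : ℤ) ∣ primitiveSum r j := by
  have : NeZero r := ⟨hr⟩
  have h := primitiveSum_eq_card (Multiplicative (ZMod r)) j
  have hdvd := card_dvd_card_trivial_stabilizer (Multiplicative (ZMod r)) j
  simp only [Nat.card_congr Multiplicative.toAdd, Nat.card_zmod] at h hdvd
  rw [h]
  exact_mod_cast hdvd

open scoped Pointwise in
theorem sum_divisors_two_mul {M : Type*} [AddCommMonoid M] {g : ℕ} (hg : Odd g) (F : ℕ → M) :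
    ∑ d ∈ (2 * g).divisors, F d = ∑ d ∈ g.divisors, F d + ∑ d ∈ g.divisors, F (2 * d) := by
  have h : (2 * g).divisors = g.divisors ∪ g.divisors.image (2 * ·) := by
    rw [Nat.divisors_mul, Nat.prime_two.divisors, Finset.insert_eq, Finset.union_mul,
      Finset.singleton_one, one_mul, Finset.singleton_mul]
    rfl
  rw [h, Finset.sum_union, Finset.sum_image]
  · intro a _ b _ hab
    exact Nat.eq_of_mul_eq_mul_left two_pos hab
  · rw [Finset.disjoint_left]
    intro a ha hb
    obtain ⟨b, -, rfl⟩ := Finset.mem_image.1 hb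
    have := hg.of_dvd_nat (Nat.dvd_of_mem_divisors ha)
    exact Nat.not_odd_iff_even.2 (even_two_mul b) this

/-- The sum defining `f`, as an integer. -/
def signedSum (r j : ℕ) : ℤ :=
  ∑ d ∈ (Nat.gcd r j).divisors,
    ArithmeticFunction.moebius d * (-1) ^ (j + j / d) * ((r / d).choose (j / d) : ℤ)

theorem neg_one_pow_add_div_of_odd {j d : ℕ} (hd : Odd d) (h : d ∣ j) :
    (-1 : ℤ) ^ (j + j / d) = 1 := by
  obtain ⟨k, rfl⟩ := h
  rw [Nat.mul_div_cancel_left _ hd.pos, show d * k + k = (d + 1) * k by ring]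
  exact (hd.add_one.mul_right k).neg_one_pow

theorem moebius_two_mul {d : ℕ} (hd : Odd d) :
    ArithmeticFunction.moebius (2 * d) = -ArithmeticFunction.moebius d := by
  rw [ArithmeticFunction.isMultiplicative_moebius.map_mul_of_coprime
    (Nat.coprime_two_left.2 hd), ArithmeticFunction.moebius_apply_prime Nat.prime_two, neg_one_mul]

theorem signedSum_eq_primitiveSum {r j : ℕ} (h : ¬(Even r ∧ j % 4 = 2)) :
    signedSum r j = primitiveSum r j := by
  refine Finset.sum_congr rfl fun d hd => ?_
  have hdg := Nat.dvd_of_mem_divisors hd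
  have hdr := hdg.trans (Nat.gcd_dvd_left r j)
  have hdj := hdg.trans (Nat.gcd_dvd_right r j)
  rcases Nat.even_or_odd d with he | ho
  · by_cases hsq : Squarefree d
    · obtain ⟨k, hk⟩ := hdj
      have hd2 := he.two_dvd
      have h4 : 4 ∣ j := by
        have : j % 4 ≠ 2 := fun hj => h ⟨even_iff_two_dvd.2 (hd2.trans hdr), hj⟩
        have : 2 ∣ j := hd2.trans ⟨k, hk⟩
        omega
      have hd4 : ¬ 4 ∣ d := fun h4 => by
        have := hsq 2 h4
        simp at this
      have hk2 : Even k := by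
        by_contra hk2
        have hodd : Odd k := Nat.not_even_iff_odd.1 hk2
        have : Nat.Coprime 4 k := by
          simpa using (Nat.coprime_two_left.2 hodd).pow_left 2
        exact hd4 (this.dvd_of_dvd_mul_right (hk ▸ h4))
      have hdpos := Nat.pos_of_mem_divisors hd
      rw [hk, Nat.mul_div_cancel_left _ hdpos, ((hk2.mul_left d).add hk2).neg_one_pow, mul_one]
    · simp [ArithmeticFunction.moebius_eq_zero_of_not_squarefree hsq]
  · rw [neg_one_pow_add_div_of_odd ho hdj, mul_one]

theorem signedSum_two_mul {s k : ℕ} (hk : Odd k) :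
    signedSum (2 * s) (2 * k) = primitiveSum (2 * s) (2 * k) + 2 * primitiveSum s k := by
  have hg : Odd (Nat.gcd s k) := hk.of_dvd_nat (Nat.gcd_dvd_right s k)
  simp only [signedSum, primitiveSum]
  rw [Nat.gcd_mul_left, sum_divisors_two_mul hg, sum_divisors_two_mul hg, Finset.mul_sum]
  simp only [← Finset.sum_add_distrib]
  refine Finset.sum_congr rfl fun d hd => ?_
  have hdk := (Nat.dvd_of_mem_divisors hd).trans (Nat.gcd_dvd_right s k)
  have hdo : Odd d := hk.of_dvd_nat hdk
  rw [neg_one_pow_add_div_of_odd hdo (hdk.mul_left 2), Nat.mul_div_mul_left _ _ two_pos,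
    Nat.mul_div_mul_left _ _ two_pos, moebius_two_mul hdo,
    ((even_two_mul k).add_odd (hk.of_dvd_nat (Nat.div_dvd_of_dvd hdk))).neg_one_pow]
  ring

theorem signedSum_nonneg_and_dvd {r : ℕ} (hr : r ≠ 0) (j : ℕ) :
    0 ≤ signedSum r j ∧ (r : ℤ) ∣ signedSum r j := by
  by_cases h : Even r ∧ j % 4 = 2
  · obtain ⟨hr2, hj⟩ := h
    obtain ⟨s, rfl⟩ := hr2.two_dvd
    obtain ⟨k, rfl⟩ : 2 ∣ j := by omega
    have hk : Odd k := by rw [Nat.odd_iff]; omega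
    have hs : s ≠ 0 := by omega
    rw [signedSum_two_mul hk]
    refine ⟨add_nonneg (primitiveSum_nonneg hr _)
      (mul_nonneg two_pos.le (primitiveSum_nonneg hs _)), dvd_add (dvd_primitiveSum hr _) ?_⟩
    push_cast
    exact mul_dvd_mul_left 2 (dvd_primitiveSum hs k)
  · rw [signedSum_eq_primitiveSum h]
    exact ⟨primitiveSum_nonneg hr j, dvd_primitiveSum hr j⟩

/-- For every `r ≥ 1` and `0 ≤ j ≤ r`, the rational number `f_j(r)` is a
nonnegative integer. -/
theorem stmt3 (r j : ℕ) (hr : 1 ≤ r) (hj : j ≤ r) :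
    ∃ m : ℕ, f r j = (m : ℚ) := by
  have hf : f r j = 1 / (r : ℚ) * (signedSum r j : ℚ) := by
    simp [f, signedSum]
  obtain ⟨hnonneg, c, hc⟩ := signedSum_nonneg_and_dvd (Nat.one_le_iff_ne_zero.1 hr) j
  have hrpos : (0 : ℤ) < r := by exact_mod_cast hr
  lift c to ℕ using nonneg_of_mul_nonneg_right (hc ▸ hnonneg) hrpos
  refine ⟨c, ?_⟩
  have : (r : ℚ) ≠ 0 := by exact_mod_cast hrpos.ne'
  rw [hf, hc]
  push_cast
  field_simp
end

section
/- For every integer r ≥ 2, the sequence m_{1,1}(r), m_{2,1}(r), …, m_{r−1,1}(r) is unimodal: there exists an index N with 1 ≤ N ≤ r−1 such that m_{i,1}(r) ≤ m_{i+1,1}(r) for all 1 ≤ i ≤ N−1 and m_{i,1}(r) ≥ m_{i+1,1}(r) for all N ≤ i ≤ r−2. -/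
open Finset

/-- `m_{i,1}(r) = Σ_{k=0}^i (−1)^{i−k} e_{k,1}(r)` where `e_{k,1}(r) = f_k(r)`:
the multiplicity of the hook `χ^{(r−i,1^i)}` in the Lie character `ψ^{(r)}`. -/
def m1 (r i : ℕ) : ℚ :=
  ∑ k ∈ Finset.range (i + 1), (-1 : ℚ) ^ (i - k) * f r k

open ArithmeticFunction in
/-- `r` times the hook multiplicity, as an explicit integer divisor sum. -/
def hookSum (r i : ℕ) : ℤ :=
  ∑ d ∈ r.divisors,
    moebius d * ((-1) ^ (i + i / d) * ((r / d - 1).choose (i / d) : ℤ))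

lemma mul_f_eq {r : ℕ} (hr : 1 ≤ r) (k : ℕ) :
    (r : ℚ) * f r k = ∑ d ∈ r.divisors, ((ArithmeticFunction.moebius d : ℤ) : ℚ) *
      if d ∣ k then (-1) ^ (k + k / d) * ((r / d).choose (k / d) : ℚ) else 0 := by
  have h0 : (r : ℚ) ≠ 0 := by positivity
  have hdiv : (Nat.gcd r k).divisors = r.divisors.filter (· ∣ k) := by
    ext d
    have hg : Nat.gcd r k ≠ 0 := Nat.gcd_ne_zero_left (by omega)
    simp [Nat.dvd_gcd_iff, hg, show r ≠ 0 by omega]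
  rw [f, ← mul_assoc, mul_one_div_cancel h0, one_mul, hdiv, Finset.sum_filter]
  refine Finset.sum_congr rfl fun d _ => ?_
  split_ifs <;> ring

lemma m1_succ (r i : ℕ) : m1 r (i + 1) = f r (i + 1) - m1 r i := by
  unfold m1
  rw [Finset.sum_range_succ, Nat.sub_self, pow_zero, one_mul, add_comm, sub_eq_add_neg,
    ← Finset.sum_neg_distrib]
  congr 1
  refine Finset.sum_congr rfl fun k hk => ?_
  rw [Nat.succ_sub (by have := Finset.mem_range.1 hk; omega), pow_succ]
  ring

lemma mul_m1_eq_hookSum {r : ℕ} (hr : 1 ≤ r) (i : ℕ) :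
    (r : ℚ) * m1 r i = (hookSum r i : ℚ) := by
  induction i with
  | zero =>
    have h : m1 r 0 = f r 0 := by simp [m1]
    rw [h, mul_f_eq hr, hookSum]
    push_cast
    refine Finset.sum_congr rfl fun d _ => ?_
    simp
  | succ i ih =>
    rw [m1_succ, mul_sub, ih, mul_f_eq hr, hookSum, hookSum, sub_eq_iff_eq_add]
    push_cast
    rw [← Finset.sum_add_distrib]
    refine Finset.sum_congr rfl fun d hd => ?_
    rw [← mul_add]
    congr 1
    have hd' := Nat.dvd_of_mem_divisors hd
    have hm : 1 ≤ r / d :=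
      Nat.div_pos (Nat.le_of_dvd hr hd') (Nat.pos_of_mem_divisors hd)
    obtain ⟨n, hn⟩ : ∃ n, r / d = n + 1 := ⟨r / d - 1, by omega⟩
    rw [Nat.succ_div, hn, Nat.add_sub_cancel]
    split_ifs with h
    · rw [Nat.choose_succ_succ]
      push_cast
      ring
    · rw [add_zero]
      ring

lemma abs_sign_mul_natCast (n c : ℕ) : |(-1 : ℤ) ^ n * (c : ℤ)| = c := by
  rw [abs_mul, abs_pow, abs_neg, abs_one, one_pow, one_mul, Nat.abs_cast]

lemma choose_div_le {r d i a b : ℕ} (hr : 1 ≤ r) (hd : d ∣ r) (hd2 : 2 ≤ d)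
    (hi : i + 1 ≤ r) (ha : i / 2 ≤ a) (hb : (r - 1 - i) / 2 ≤ b) :
    (r / d - 1).choose (i / d) ≤ (a + b).choose a := by
  have h1 : i / d ≤ a := (Nat.div_le_div_left hd2 (by norm_num)).trans ha
  have h2 : r / d - 1 ≤ i / d + b := by
    obtain ⟨m, rfl⟩ := hd
    rw [Nat.mul_div_cancel_left _ (by omega)]
    by_contra! hlt
    have h3 : i < d * (i / d + 1) := Nat.lt_mul_div_succ i (by omega)
    generalize i / d = q at *
    have h4 : 2 * (b + 1) ≤ d * (b + 1) := Nat.mul_le_mul_right _ hd2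
    have h5 : d * (q + 1 + (b + 1)) ≤ d * m := Nat.mul_le_mul_left _ (by omega)
    rw [Nat.mul_add] at h5
    omega
  calc (r / d - 1).choose (i / d) ≤ (i / d + b).choose (i / d) := Nat.choose_le_choose _ h2
    _ = (i / d + b).choose b := Nat.choose_symm_add
    _ ≤ (a + b).choose b := Nat.choose_le_choose _ (by omega)
    _ = (a + b).choose a := Nat.choose_symm_add.symm

lemma abs_hookSum_diff_sub_le {r i : ℕ} (hi : i + 2 ≤ r) :
    |hookSum r (i + 1) - hookSum r i - (((r - 1).choose (i + 1) : ℤ) - (r - 1).choose i)| ≤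
      2 * (r.divisors.erase 1).card *
        (((i + 1) / 2 + (r - (i + 1)) / 2).choose ((i + 1) / 2) : ℤ) := by
  have h1 : 1 ∈ r.divisors := by simp; omega
  rw [hookSum, hookSum, ← Finset.sum_sub_distrib, ← Finset.add_sum_erase _ _ h1]
  have hmain : ∀ j : ℕ, (-1 : ℤ) ^ (j + j) = 1 := fun j => Even.neg_one_pow ⟨j, rfl⟩
  simp only [Nat.div_one, hmain, ArithmeticFunction.moebius_apply_one, one_mul,
    add_sub_cancel_left]
  refine (Finset.abs_sum_le_sum_abs _ _).trans ?_
  refine (Finset.sum_le_card_nsmul _ _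
    (2 * (((i + 1) / 2 + (r - (i + 1)) / 2).choose ((i + 1) / 2) : ℤ)) fun d hd => ?_).trans ?_
  · obtain ⟨hd1, hdr⟩ := Finset.mem_erase.1 hd
    have hd2 : 2 ≤ d := by have := Nat.pos_of_mem_divisors hdr; omega
    have hdvd := Nat.dvd_of_mem_divisors hdr
    have b1 : (r / d - 1).choose ((i + 1) / d) ≤
        ((i + 1) / 2 + (r - (i + 1)) / 2).choose ((i + 1) / 2) :=
      choose_div_le (by omega) hdvd hd2 (by omega) le_rfl (by omega)
    have b2 : (r / d - 1).choose (i / d) ≤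
        ((i + 1) / 2 + (r - (i + 1)) / 2).choose ((i + 1) / 2) :=
      choose_div_le (by omega) hdvd hd2 (by omega) (by omega) (by omega)
    rw [← mul_sub, abs_mul]
    refine (mul_le_of_le_one_left (abs_nonneg _) ArithmeticFunction.abs_moebius_le_one).trans ?_
    refine (abs_sub _ _).trans ?_
    rw [abs_sign_mul_natCast, abs_sign_mul_natCast]
    have b1' := Int.ofNat_le.2 b1
    have b2' := Int.ofNat_le.2 b2
    linarith
  · rw [nsmul_eq_mul]
    exact le_of_eq (by ring)

lemma three_mul_card_divisors_erase_one_le {r : ℕ} (hr : 3 ≤ r) :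
    3 * (r.divisors.erase 1).card ≤ r + 3 := by
  have hsub : r.divisors.erase 1 ⊆ insert r (insert (r / 2) (Finset.Icc 2 (r / 3))) := by
    intro d hd
    obtain ⟨hd1, hdr⟩ := Finset.mem_erase.1 hd
    obtain ⟨m, hm⟩ := Nat.dvd_of_mem_divisors hdr
    have hpos := Nat.pos_of_mem_divisors hdr
    simp only [Finset.mem_insert, Finset.mem_Icc]
    rcases (by omega : m = 0 ∨ m = 1 ∨ m = 2 ∨ 3 ≤ m) with rfl | rfl | rfl | h
    · omega
    · omega
    · omega
    · have : d * 3 ≤ d * m := Nat.mul_le_mul_left _ h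
      omega
  have h := (Finset.card_le_card hsub).trans
    ((Finset.card_insert_le _ _).trans (Nat.add_le_add_right (Finset.card_insert_le _ _) 1))
  rw [Nat.card_Icc] at h
  omega

lemma choose_le_choose_right_of_le_half {n a b : ℕ} (hab : a ≤ b) (hb : b ≤ n / 2) :
    n.choose a ≤ n.choose b := by
  induction b, hab using Nat.le_induction with
  | base => exact le_rfl
  | succ b _ ih =>
    exact (ih (by omega)).trans (Nat.choose_le_succ_of_lt_half_left (by omega))

lemma choose_mul_choose_le (m n a b : ℕ) :
    m.choose a * n.choose b ≤ (m + n).choose (a + b) := by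
  rw [Nat.add_choose_eq]
  exact Finset.single_le_sum (f := fun ij : ℕ × ℕ => m.choose ij.1 * n.choose ij.2)
    (fun _ _ => Nat.zero_le _) (show (a, b) ∈ HasAntidiagonal.antidiagonal (a + b) by simp)

lemma six_mul_choose_three (n : ℕ) : 6 * (n + 2).choose 3 = (n + 2) * (n + 1) * n := by
  have h1 := Nat.add_one_mul_choose_eq (n + 1) 2
  have h2 := Nat.add_one_mul_choose_eq n 1
  rw [Nat.choose_one_right] at h2
  nlinarith

lemma two_mul_choose_two (n : ℕ) : 2 * (n + 1).choose 2 = (n + 1) * n := by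
  have h2 := Nat.add_one_mul_choose_eq n 1
  rw [Nat.choose_one_right] at h2
  linarith

lemma error_le_main_of_lt {k l T : ℕ} (hk : 1 ≤ k) (hkl : k < l) (hr : 41 ≤ k + l)
    (hT : 3 * T ≤ k + l + 3) :
    2 * T * (k / 2 + l / 2).choose (k / 2) * (k + l) ≤ (k + l).choose k * (l - k) := by
  obtain ⟨e, rfl⟩ : ∃ e, l = k + e := ⟨l - k, by omega⟩
  rw [Nat.add_sub_cancel_left]
  rcases (by omega : k = 1 ∨ k = 2 ∨ 3 ≤ k) with rfl | rfl | hk3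
  · simp only [Nat.reduceDiv, Nat.choose_zero_right, Nat.choose_one_right]
    nlinarith
  · have hC : (2 / 2 + (2 + e) / 2).choose (2 / 2) = 1 + (2 + e) / 2 := by simp
    have h2 := two_mul_choose_two (e + 3)
    rw [hC, show 2 + (2 + e) = e + 3 + 1 by ring]
    have h3 : 2 * (1 + (2 + e) / 2) ≤ e + 4 := by omega
    have h4 : 2 * T * (e + 4) ≤ (e + 3) * e := by nlinarith
    calc 2 * T * (1 + (2 + e) / 2) * (e + 3 + 1)
        = T * (e + 4) * (2 * (1 + (2 + e) / 2)) := by ring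
      _ ≤ T * (e + 4) * (e + 4) := Nat.mul_le_mul_left _ h3
      _ ≤ (e + 3 + 1).choose 2 * e := by nlinarith
  · set a := k - k / 2 with ha
    set b := (k + e) - (k + e) / 2 with hb
    have hsplit := choose_mul_choose_le (k / 2 + (k + e) / 2) (a + b) (k / 2) a
    rw [show k / 2 + (k + e) / 2 + (a + b) = k + (k + e) by omega,
      show k / 2 + a = k by omega] at hsplit
    have key : 2 * T * (k + (k + e)) ≤ (a + b).choose a * e := by
      obtain ⟨n, hn⟩ : ∃ n, a + b = n + 2 := ⟨a + b - 2, by omega⟩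
      have hn2 : k + (k + e) ≤ 2 * (n + 2) := by omega
      rw [hn]
      rcases (by omega : a = 2 ∨ 3 ≤ a) with h2 | h3
      · rw [h2]
        have hc : 2 * (n + 2).choose 2 = (n + 2) * (n + 1) := two_mul_choose_two (n + 1)
        have he : k + (k + e) ≤ e + 8 := by omega
        obtain ⟨w, hw⟩ : ∃ w, k + (k + e) = w + 8 := ⟨k + (k + e) - 8, by omega⟩
        rw [hw] at hT hr hn2 he ⊢
        have hTw : 48 * T ≤ 3 * (w + 6) * w := by nlinarith
        have h1 : (w + 6) * w ≤ (2 * (n + 1)) * e := Nat.mul_le_mul (by omega) (by omega)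
        have h3 : (w + 6) * w * (w + 8) ≤ (2 * (n + 1)) * e * (2 * (n + 2)) :=
          Nat.mul_le_mul h1 hn2
        have h4 : 48 * T * (w + 8) ≤ 3 * (w + 6) * w * (w + 8) := Nat.mul_le_mul_right _ hTw
        have h5 : (2 * (n + 1)) * e * (2 * (n + 2)) = 8 * ((n + 2).choose 2 * e) := by
          rw [show 8 * ((n + 2).choose 2 * e) = 4 * e * (2 * (n + 2).choose 2) by ring, hc]
          ring
        linarith
      · have hc := six_mul_choose_three n
        have hmono : (n + 2).choose 3 ≤ (n + 2).choose a :=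
          choose_le_choose_right_of_le_half h3 (by omega)
        have he : 1 ≤ e := by omega
        obtain ⟨w, hw⟩ : ∃ w, k + (k + e) = w + 4 := ⟨k + (k + e) - 4, by omega⟩
        rw [hw] at hT hr hn2 ⊢
        have hTw : 96 * T ≤ (w + 2) * w := by nlinarith
        have h1 : (w + 2) * w ≤ (2 * (n + 1)) * (2 * n) := Nat.mul_le_mul (by omega) (by omega)
        have h4 : 96 * T * (w + 4) ≤ (2 * (n + 1)) * (2 * n) * (2 * (n + 2)) :=
          Nat.mul_le_mul (hTw.trans h1) hn2
        have h5 : (n + 2).choose a ≤ (n + 2).choose a * e := Nat.le_mul_of_pos_right _ he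
        linarith
    calc 2 * T * (k / 2 + (k + e) / 2).choose (k / 2) * (k + (k + e))
        = (k / 2 + (k + e) / 2).choose (k / 2) * (2 * T * (k + (k + e))) := by ring
      _ ≤ (k / 2 + (k + e) / 2).choose (k / 2) * ((a + b).choose a * e) :=
          Nat.mul_le_mul_left _ key
      _ = (k / 2 + (k + e) / 2).choose (k / 2) * (a + b).choose a * e := by ring
      _ ≤ (k + (k + e)).choose k * e := Nat.mul_le_mul_right _ hsplit

lemma mul_choose_sub_choose {r i : ℕ} (hi : i + 1 ≤ r) :
    (r : ℤ) * (((r - 1).choose (i + 1) : ℤ) - (r - 1).choose i) =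
      r.choose (i + 1) * ((r : ℤ) - 2 * (i + 1)) := by
  obtain ⟨n, rfl⟩ : ∃ n, r = n + 1 := ⟨r - 1, by omega⟩
  rw [Nat.add_sub_cancel]
  have h1 := congrArg (Nat.cast : ℕ → ℤ) (Nat.add_one_mul_choose_eq n i)
  have h2 := congrArg (Nat.cast : ℕ → ℤ) (Nat.choose_succ_succ n i)
  push_cast at h1 h2 ⊢
  linear_combination (-2 : ℤ) * h1 - (n + 1 : ℤ) * h2

/-- The values of the Möbius function at `0, …, 40`. -/
def moebiusTable : List ℤ :=
  [0, 1, -1, -1, 0, -1, 1, -1, 0, 0, 1, -1, 0, -1, 1, 1, 0, -1, 0, -1, 0,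
    1, 1, -1, 0, 0, 1, 0, 0, -1, -1, -1, 0, 1, 1, 1, 0, -1, 1, 1, 0]

lemma moebius_eq_moebiusTable :
    ∀ d ∈ Finset.range 41, ArithmeticFunction.moebius d = moebiusTable.getD d 0 := by
  decide +kernel

/-- A form of `hookSum`, valid for `r ≤ 40`, that evaluates quickly. -/
def hookSumEval (r i : ℕ) : ℤ :=
  ∑ d ∈ r.divisors, moebiusTable.getD d 0 * ((if (i + i / d) % 2 = 0 then 1 else -1) *
    (((r / d - 1).descFactorial (i / d) / (i / d).factorial : ℕ) : ℤ))

lemma hookSum_eq_hookSumEval {r : ℕ} (hr : r < 41) (i : ℕ) :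
    hookSum r i = hookSumEval r i := by
  refine Finset.sum_congr rfl fun d hd => ?_
  have hdr := Nat.divisor_le hd
  rw [moebius_eq_moebiusTable d (Finset.mem_range.2 (by omega)),
    Nat.choose_eq_descFactorial_div_factorial, neg_one_pow_eq_ite]
  simp only [Nat.even_iff]

lemma hookSumEval_monotone_then_antitone :
    ∀ r ∈ Finset.range 41, ∀ i ∈ Finset.range (r - 1),
      (2 * (i + 1) < r → hookSumEval r i ≤ hookSumEval r (i + 1)) ∧
        (1 ≤ i → r < 2 * (i + 1) → hookSumEval r (i + 1) ≤ hookSumEval r i) := by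
  decide +kernel

lemma hookSum_monotone_then_antitone_small {r i : ℕ} (hr : r < 41) (hi : i + 2 ≤ r) :
    (2 * (i + 1) < r → hookSum r i ≤ hookSum r (i + 1)) ∧
      (1 ≤ i → r < 2 * (i + 1) → hookSum r (i + 1) ≤ hookSum r i) := by
  rw [hookSum_eq_hookSumEval hr, hookSum_eq_hookSumEval hr]
  exact hookSumEval_monotone_then_antitone r (Finset.mem_range.2 hr) i
    (Finset.mem_range.2 (by omega))

lemma hookSum_le_succ {r i : ℕ} (hi : 2 * (i + 1) < r) :
    hookSum r i ≤ hookSum r (i + 1) := by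
  by_cases hr : r < 41
  · exact (hookSum_monotone_then_antitone_small hr (by omega)).1 hi
  have hdiff := (abs_le.1 (abs_hookSum_diff_sub_le (r := r) (i := i) (by omega))).1
  have hmain := mul_choose_sub_choose (r := r) (i := i) (by omega)
  obtain ⟨l, hl⟩ : ∃ l, r = i + 1 + l := ⟨r - (i + 1), by omega⟩
  have herr := error_le_main_of_lt (k := i + 1) (l := l) (T := (r.divisors.erase 1).card)
    (by omega) (by omega) (by omega)
    (by have := three_mul_card_divisors_erase_one_le (r := r) (by omega); omega)
  rw [← hl] at herr
  rw [show r - (i + 1) = l by omega] at hdiff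
  have herr' := Int.ofNat_le.2 herr
  push_cast [Nat.cast_sub (show i + 1 ≤ l by omega)] at herr'
  have hl' : (r : ℤ) = i + 1 + l := by exact_mod_cast hl
  have hrpos : (0 : ℤ) < r := by omega
  rw [show (r : ℤ) - 2 * (i + 1) = l - (i + 1) by rw [hl']; ring, mul_comm (r : ℤ)] at hmain
  rw [← hmain] at herr'
  have := le_of_mul_le_mul_right herr' hrpos
  linarith

lemma hookSum_succ_le {r i : ℕ} (hi1 : 1 ≤ i) (hir : i + 2 ≤ r) (hi : r < 2 * (i + 1)) :
    hookSum r (i + 1) ≤ hookSum r i := by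
  by_cases hr : r < 41
  · exact (hookSum_monotone_then_antitone_small hr (by omega)).2 hi1 hi
  have hdiff := (abs_le.1 (abs_hookSum_diff_sub_le (r := r) (i := i) (by omega))).2
  have hmain := mul_choose_sub_choose (r := r) (i := i) (by omega)
  obtain ⟨l, hl⟩ : ∃ l, r = l + (i + 1) := ⟨r - (i + 1), by omega⟩
  have herr := error_le_main_of_lt (k := l) (l := i + 1) (T := (r.divisors.erase 1).card)
    (by omega) (by omega) (by omega)
    (by have := three_mul_card_divisors_erase_one_le (r := r) (by omega); omega)
  rw [Nat.choose_symm_add, Nat.choose_symm_add, add_comm (l / 2), ← hl] at herr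
  rw [show r - (i + 1) = l by omega] at hdiff
  have herr' := Int.ofNat_le.2 herr
  push_cast [Nat.cast_sub (show l ≤ i + 1 by omega)] at herr'
  have hl' : (r : ℤ) = l + (i + 1) := by exact_mod_cast hl
  have hrpos : (0 : ℤ) < r := by omega
  rw [show (r : ℤ) - 2 * (i + 1) = -((i + 1) - l) by rw [hl']; ring, mul_comm (r : ℤ),
    mul_neg, ← neg_eq_iff_eq_neg, ← neg_mul] at hmain
  rw [← hmain] at herr'
  have := le_of_mul_le_mul_right herr' hrpos
  linarith

lemma m1_le_m1_iff {r : ℕ} (hr : 1 ≤ r) (i j : ℕ) :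
    m1 r i ≤ m1 r j ↔ hookSum r i ≤ hookSum r j := by
  have h0 : (0 : ℚ) < r := by positivity
  rw [← mul_le_mul_iff_right₀ h0, mul_m1_eq_hookSum hr, mul_m1_eq_hookSum hr, Int.cast_le]

/-- For `r ≥ 2` the sequence `m_{1,1}(r), …, m_{r−1,1}(r)` is unimodal. -/
theorem stmt8 (r : ℕ) (hr : 2 ≤ r) :
    ∃ N : ℕ, 1 ≤ N ∧ N ≤ r - 1 ∧
      (∀ i, 1 ≤ i → i ≤ N - 1 → m1 r i ≤ m1 r (i + 1)) ∧
      (∀ i, N ≤ i → i ≤ r - 2 → m1 r (i + 1) ≤ m1 r i) := by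
  obtain rfl | h3 : r = 2 ∨ 3 ≤ r := by omega
  · exact ⟨1, le_rfl, le_rfl, fun i _ _ => by omega, fun i _ _ => by omega⟩
  simp only [m1_le_m1_iff (show 1 ≤ r by omega)]
  by_cases hmid : 4 ≤ r ∧ r % 2 = 0 ∧ hookSum r (r / 2) ≤ hookSum r (r / 2 - 1)
  · obtain ⟨h4, heven, hle⟩ := hmid
    refine ⟨r / 2 - 1, by omega, by omega, fun i _ _ => hookSum_le_succ (by omega),
      fun i _ _ => ?_⟩
    obtain h | h : i = r / 2 - 1 ∨ r < 2 * (i + 1) := by omega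
    · rw [h, show r / 2 - 1 + 1 = r / 2 by omega]
      exact hle
    · exact hookSum_succ_le (by omega) (by omega) h
  · refine ⟨r / 2, by omega, by omega, fun i _ _ => ?_,
      fun i _ _ => hookSum_succ_le (by omega) (by omega) (by omega)⟩
    obtain h | h : 2 * (i + 1) = r ∨ 2 * (i + 1) < r := by omega
    · have hlt : ¬ hookSum r (r / 2) ≤ hookSum r (r / 2 - 1) :=
        fun hle => hmid ⟨by omega, by omega, hle⟩
      rw [show i = r / 2 - 1 by omega, show r / 2 - 1 + 1 = r / 2 by omega]
      exact (not_le.1 hlt).le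
    · exact hookSum_le_succ h
end

section
/- Fix an integer r ≥ 1 and set N_{r,s}(x) := Σ_{i=0}^{rs−1} m_{i,s}(r)·x^i ∈ ℚ[x]. The following are equivalent: (i) (1+x) divides N_{r,1}(x); (ii) for every s ≥ 1, (1+x) divides N_{r,s}(x); (iii) r is not squarefree. Moreover, if these hold then for every s ≥ 1 the quotient N_{r,s}(x)/(1+x) is a polynomial with nonnegative integer coefficients. -/
open Finset

/-- `f_j(r)` as a natural number (the paper proves `f_j(r)` is a nonnegative integer). -/
def fNat (r j : ℕ) : ℕ := (f r j).num.toNat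

/-- The set `P(i)_r^s` of partitions `γ = (γ_1 ≥ … ≥ γ_s ≥ 0)` with `Σ γ_l = i` and
`γ_1 ≤ r`, encoded as multisets of size `s` with entries in `{0,…,r}`. -/
def Pset (r s i : ℕ) : Finset (Sym (Fin (r + 1)) s) :=
  Finset.univ.filter fun γ => ((γ : Multiset (Fin (r + 1))).map Fin.val).sum = i

/-- The multiplicity `k_j(γ)` of the part `j` in `γ`. -/
def kmult {r s : ℕ} (γ : Sym (Fin (r + 1)) s) (j : ℕ) : ℕ :=
  ((γ : Multiset (Fin (r + 1))).map Fin.val).count j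

/-- `e_{i,s}(r) = Σ_{γ ∈ P(i)_r^s} Π_{j : k_j(γ)>0} C(f_j(r) + (k_j(γ)−1)δ_j, k_j(γ))`,
where `δ_j = 1` if `j` is even and `0` if `j` is odd. -/
def e (r s i : ℕ) : ℕ :=
  ∑ γ ∈ Pset r s i, ∏ j ∈ Finset.range (r + 1),
    if 0 < kmult γ j then
      (fNat r j + (kmult γ j - 1) * (if j % 2 = 0 then 1 else 0)).choose (kmult γ j)
    else 1

/-- `m_{i,s}(r) = Σ_{k=0}^i (−1)^{i−k} e_{k,s}(r)`, the multiplicity of the hook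
character `χ^{(rs−i,1^i)}` in the higher Lie character `ψ^{(r^s)}`. -/
def mm (r s i : ℕ) : ℚ :=
  ∑ k ∈ Finset.range (i + 1), (-1 : ℚ) ^ (i - k) * (e r s k : ℚ)

open Polynomial in
/-- `N_{r,s}(x) = Σ_{i=0}^{rs−1} m_{i,s}(r) x^i ∈ ℚ[x]`. -/
noncomputable def N (r s : ℕ) : Polynomial ℚ :=
  ∑ i ∈ Finset.range (r * s), C (mm r s i) * X ^ i


section RootsOfUnity

open Polynomial

theorem IsPrimitiveRoot.nthRootsFinset_one_eq_image {R : Type*} [CommRing R] [IsDomain R]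
    [DecidableEq R] {ζ : R} {n : ℕ} (h : IsPrimitiveRoot ζ n) (hn : 0 < n) :
    nthRootsFinset n (1 : R) = (range n).image (ζ ^ ·) := by
  ext x
  rw [Polynomial.mem_nthRootsFinset hn, mem_image]
  constructor
  · intro hx
    have : NeZero n := ⟨hn.ne'⟩
    obtain ⟨i, hi, rfl⟩ := h.eq_pow_of_pow_eq_one hx
    exact ⟨i, mem_range.2 hi, rfl⟩
  · rintro ⟨i, -, rfl⟩
    rw [← pow_mul, mul_comm, pow_mul, h.pow_eq_one, one_pow]

theorem IsPrimitiveRoot.injOn_pow_range {R : Type*} [CommRing R] [IsDomain R] {ζ : R} {n : ℕ}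
    (h : IsPrimitiveRoot ζ n) : Set.InjOn (ζ ^ ·) (range n) := fun i hi j hj hij =>
  h.pow_inj (by simpa using hi) (by simpa using hj) hij

theorem sum_nthRootsFinset_one_pow {m : ℕ} (hm : 0 < m) (k : ℕ) :
    ∑ ζ ∈ nthRootsFinset m (1 : ℂ), ζ ^ k = if m ∣ k then (m : ℂ) else 0 := by
  have h := Complex.isPrimitiveRoot_exp m hm.ne'
  set ω := Complex.exp (2 * Real.pi * Complex.I / m)
  rw [h.nthRootsFinset_one_eq_image hm, sum_image h.injOn_pow_range]
  have hpow (i : ℕ) : (ω ^ i) ^ k = (ω ^ k) ^ i := by rw [← pow_mul, ← pow_mul, mul_comm]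
  simp only [hpow]
  split_ifs with hk
  · simp [h.pow_eq_one_iff_dvd k |>.2 hk]
  · have h1 : ω ^ k ≠ 1 := fun h' => hk (h.dvd_of_pow_eq_one k h')
    rw [geom_sum_eq h1, ← hpow, h.pow_eq_one, one_pow, sub_self, zero_div]

theorem sum_primitiveRoots_inv {d : ℕ} (hd : 0 < d) :
    ∑ ζ ∈ primitiveRoots d ℂ, ζ⁻¹ = (ArithmeticFunction.moebius d : ℂ) := by
  have key : ∀ n > 0, ∑ i ∈ n.divisors, ∑ ζ ∈ primitiveRoots i ℂ, ζ⁻¹ =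
      (if n = 1 then (1 : ℂ) else 0) := by
    intro n hn
    rw [← sum_biUnion fun i _ j _ hij => IsPrimitiveRoot.disjoint hij,
      ← IsPrimitiveRoot.nthRoots_one_eq_biUnion_primitiveRoots]
    have h1 : ∀ ζ ∈ nthRootsFinset n (1 : ℂ), ζ⁻¹ = ζ ^ (n - 1) := by
      intro ζ hζ
      rw [mem_nthRootsFinset hn] at hζ
      exact inv_eq_of_mul_eq_one_right (by rw [← pow_succ', Nat.sub_add_cancel hn, hζ])
    rw [sum_congr rfl h1, sum_nthRootsFinset_one_pow hn]
    by_cases h : n = 1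
    · simp [h]
    · rw [if_neg h, if_neg]
      intro h'
      have := Nat.le_of_dvd (by omega) h'
      omega
  rw [← ArithmeticFunction.sum_eq_iff_sum_mul_moebius_eq.1 key d hd]
  rw [Nat.sum_divisorsAntidiagonal
    (fun a b => (ArithmeticFunction.moebius a : ℂ) * if b = 1 then (1 : ℂ) else 0)]
  rw [sum_eq_single d]
  · simp [Nat.div_self hd]
  · intro b hb hbd
    rw [if_neg, mul_zero]
    intro h
    exact hbd (Nat.eq_of_dvd_of_div_eq_one (Nat.dvd_of_mem_divisors hb) h)
  · simp [hd.ne']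

theorem IsPrimitiveRoot.prod_range_one_add_C_mul_X {ζ : ℂ} {d : ℕ} (h : IsPrimitiveRoot ζ d)
    (hd : 0 < d) (q : ℕ) :
    ∏ a ∈ range (d * q), (1 + C (ζ ^ a) * X) = (1 - (-X) ^ d) ^ q := by
  induction q with
  | zero => simp
  | succ q ih =>
    rw [mul_add, mul_one, prod_range_add, ih, pow_succ]
    congr 1
    have hC : IsPrimitiveRoot (C ζ) d := h.map_of_injective C_injective
    rw [← one_pow (M := ℂ[X]) d, hC.pow_sub_pow_eq_prod_sub_mul 1 (-X) hd,
      hC.nthRootsFinset_one_eq_image hd, prod_image hC.injOn_pow_range]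
    refine prod_congr rfl fun a _ => ?_
    rw [pow_add, pow_mul, h.pow_eq_one]
    simp

end RootsOfUnity

section SubsetSums

open Polynomial

/-- The generating polynomial, by cardinality, of the subsets of `S` whose sum is `1` modulo `m`. -/
noncomputable def subsetPoly (S : Finset ℕ) (m : ℕ) : ℕ[X] :=
  ∑ A ∈ S.powerset with m ∣ (m - 1) + ∑ a ∈ A, a, X ^ #A

theorem nsmul_map_subsetPoly (S : Finset ℕ) {m : ℕ} (hm : 0 < m) :
    m • (subsetPoly S m).map (Nat.castRingHom ℂ) =
      ∑ ζ ∈ nthRootsFinset m (1 : ℂ), C (ζ ^ (m - 1)) * ∏ a ∈ S, (1 + C (ζ ^ a) * X) := by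
  have h (A : Finset ℕ) (ζ : ℂ) : C (ζ ^ (m - 1)) * ∏ a ∈ A, (C (ζ ^ a) * X) =
      C (ζ ^ (m - 1 + ∑ a ∈ A, a)) * X ^ #A := by
    rw [prod_mul_distrib, prod_const, pow_add, C_mul, ← prod_pow_eq_pow_sum, map_prod C, mul_assoc]
  simp only [prod_one_add, mul_sum, h]
  rw [sum_comm]
  simp only [← sum_mul, ← map_sum C, sum_nthRootsFinset_one_pow hm]
  rw [subsetPoly, Polynomial.map_sum, smul_sum, sum_filter]
  refine sum_congr rfl fun A _ => ?_
  split_ifs <;> simp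

theorem nsmul_map_subsetPoly_range {r m : ℕ} (hr : 0 < r) (hm : m ∣ r) :
    m • (subsetPoly (range r) m).map (Nat.castRingHom ℂ) =
      ∑ d ∈ m.divisors, C (ArithmeticFunction.moebius d : ℂ) * (1 - (-X) ^ d) ^ (r / d) := by
  have hm0 : 0 < m := Nat.pos_of_dvd_of_pos hm hr
  rw [nsmul_map_subsetPoly _ hm0, IsPrimitiveRoot.nthRoots_one_eq_biUnion_primitiveRoots,
    sum_biUnion fun i _ j _ hij => IsPrimitiveRoot.disjoint hij]
  refine sum_congr rfl fun d hd => ?_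
  have hdm := Nat.dvd_of_mem_divisors hd
  have hd0 : 0 < d := Nat.pos_of_dvd_of_pos hdm hm0
  rw [← sum_primitiveRoots_inv hd0, map_sum C, sum_mul]
  refine sum_congr rfl fun ζ hζ => ?_
  have hζ' := (mem_primitiveRoots hd0).1 hζ
  congr 2
  · refine (inv_eq_of_mul_eq_one_right ?_).symm
    rw [← pow_succ', Nat.sub_add_cancel hm0]
    exact (hζ'.pow_eq_one_iff_dvd m).2 hdm
  · rw [← hζ'.prod_range_one_add_C_mul_X hd0, Nat.mul_div_cancel' (hdm.trans hm)]

theorem subsetPoly_range_eq_sq_mul {r m : ℕ} (hm0 : 0 < m) (hmr : m < r) :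
    subsetPoly (range r) m = (1 + X) ^ 2 * subsetPoly (((range r).erase 0).erase m) m := by
  apply map_injective (Nat.castRingHom ℂ) Nat.cast_injective
  apply smul_right_injective _ hm0.ne'
  simp only
  rw [Polynomial.map_mul, ← mul_smul_comm, nsmul_map_subsetPoly _ hm0, nsmul_map_subsetPoly _ hm0,
    mul_sum]
  refine sum_congr rfl fun ζ hζ => ?_
  rw [mem_nthRootsFinset hm0] at hζ
  rw [← mul_prod_erase (range r) _ (mem_range.2 (hm0.trans hmr)),
    ← mul_prod_erase ((range r).erase 0) _ (mem_erase.2 ⟨hm0.ne', mem_range.2 hmr⟩), hζ]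
  simp only [pow_zero, map_one, Polynomial.map_pow, Polynomial.map_add, Polynomial.map_one, map_X]
  ring

end SubsetSums

section HookNumbers

open Polynomial

theorem coeff_one_sub_neg_X_pow_pow {R : Type*} [CommRing R] {d : ℕ} (hd : 0 < d) (n j : ℕ) :
    ((1 - (-X : R[X]) ^ d) ^ n).coeff j =
      if d ∣ j then (-1) ^ (j + j / d) * (n.choose (j / d) : R) else 0 := by
  have h : (1 - (-X : R[X]) ^ d) ^ n = expand R d (((1 + X) ^ n).comp (C (-(-1) ^ d) * X)) := by
    rw [pow_comp, add_comp, one_comp, X_comp, map_pow, map_add, map_one, map_mul, expand_C,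
      expand_X, neg_pow (X : R[X]) d, C_neg, C_pow, C_neg, C_1, neg_mul, sub_eq_add_neg]
  rw [h, coeff_expand hd]
  refine if_ctx_congr Iff.rfl (fun ⟨k, hk⟩ => ?_) fun _ => rfl
  rw [comp_C_mul_X_coeff, coeff_one_add_X_pow, hk, Nat.mul_div_cancel_left _ hd, neg_pow,
    ← pow_mul, pow_add]
  ring

theorem f_eq_coeff_subsetPoly {r : ℕ} (hr : 0 < r) (j : ℕ) :
    f r j = (subsetPoly (range r) r).coeff j := by
  have hr' : (r : ℂ) ≠ 0 := Nat.cast_ne_zero.2 hr.ne'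
  suffices h : ((f r j : ℚ) : ℂ) = ((subsetPoly (range r) r).coeff j : ℂ) by exact_mod_cast h
  have h := congrArg (coeff · j) (nsmul_map_subsetPoly_range hr dvd_rfl)
  simp only [coeff_smul, coeff_map, finsetSum_coeff, coeff_C_mul] at h
  rw [nsmul_eq_mul, eq_natCast] at h
  have hgcd : (r.gcd j).divisors = r.divisors.filter (· ∣ j) := by
    ext d
    simp [Nat.dvd_gcd_iff, hr.ne', and_comm]
  rw [← mul_right_inj' hr', h, f, hgcd, sum_filter]
  push_cast
  rw [← mul_assoc, mul_one_div_cancel hr', one_mul]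
  refine sum_congr rfl fun d hd => ?_
  rw [coeff_one_sub_neg_X_pow_pow (Nat.pos_of_mem_divisors hd)]
  split_ifs
  · push_cast
    ring
  · simp

theorem coeff_subsetPoly_eq_fNat {r : ℕ} (hr : 0 < r) (j : ℕ) :
    (subsetPoly (range r) r).coeff j = fNat r j := by
  rw [fNat, f_eq_coeff_subsetPoly hr]
  simp

theorem natDegree_subsetPoly_range_le (r m : ℕ) : (subsetPoly (range r) m).natDegree ≤ r := by
  refine natDegree_sum_le_of_forall_le _ _ fun A hA => ?_
  rw [natDegree_X_pow]
  simpa using card_le_card (mem_powerset.1 (mem_filter.1 hA).1)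

theorem subsetPoly_range_eq_sum {r : ℕ} (hr : 0 < r) :
    subsetPoly (range r) r = ∑ j ∈ range (r + 1), C (fNat r j) * X ^ j := by
  rw [(subsetPoly (range r) r).as_sum_range_C_mul_X_pow'
    (Nat.lt_succ_of_le (natDegree_subsetPoly_range_le r r))]
  simp only [coeff_subsetPoly_eq_fNat hr, Nat.succ_eq_add_one]

theorem eval_neg_one_subsetPoly_range {r : ℕ} (hr : 0 < r) :
    ((subsetPoly (range r) r).map (Nat.castRingHom ℂ)).eval (-1) = 0 := by
  have h := congrArg (eval (-1)) (nsmul_map_subsetPoly_range hr dvd_rfl)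
  rw [eval_smul, eval_finsetSum, sum_eq_zero, smul_eq_zero_iff_right hr.ne'] at h
  · exact h
  · intro d hd
    have : 0 < r / d := Nat.div_pos (Nat.divisor_le hd) (Nat.pos_of_mem_divisors hd)
    simp [this.ne']

theorem eval_neg_one_derivative_subsetPoly_range {r : ℕ} (hr : 0 < r) :
    r * (derivative ((subsetPoly (range r) r).map (Nat.castRingHom ℂ))).eval (-1) =
      r * (ArithmeticFunction.moebius r : ℂ) := by
  have h := congrArg (fun p => eval (-1) (derivative p)) (nsmul_map_subsetPoly_range hr dvd_rfl)
  simp only [derivative_smul, eval_smul, derivative_sum, eval_finsetSum] at h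
  rw [← nsmul_eq_mul, h, sum_eq_single_of_mem r (Nat.mem_divisors_self r hr.ne')]
  · rw [Nat.div_self hr]
    simp [derivative_pow]
    ring
  · intro d hd hdr
    have h1 : 1 < r / d := by
      have h0 : 0 < r / d := Nat.div_pos (Nat.divisor_le hd) (Nat.pos_of_mem_divisors hd)
      have h1 : r / d ≠ 1 := fun h1 =>
        hdr (Nat.eq_of_dvd_of_div_eq_one (Nat.dvd_of_mem_divisors hd) h1)
      omega
    have : r / d - 1 ≠ 0 := by omega
    simp [derivative_pow, this]

theorem not_squarefree_of_sq_dvd_subsetPoly {r : ℕ} (hr : 0 < r)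
    (h : (1 + X) ^ 2 ∣ (subsetPoly (range r) r).map (Nat.castRingHom ℂ)) : ¬ Squarefree r := by
  rw [← ArithmeticFunction.moebius_ne_zero_iff_squarefree, not_not]
  obtain ⟨q, hq⟩ := h
  have h := eval_neg_one_derivative_subsetPoly_range hr
  rw [hq] at h
  have h' : (ArithmeticFunction.moebius r : ℂ) = 0 := by
    simpa [derivative_pow, hr.ne', eq_comm] using h
  exact_mod_cast h'

theorem exists_squarefree_dvd_of_not_squarefree {r : ℕ} (hr : 0 < r) (h : ¬ Squarefree r) :
    ∃ m p, 0 < m ∧ 1 < p ∧ r = m * p ∧ ∀ d, Squarefree d → d ∣ r → d ∣ m := by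
  rw [Nat.squarefree_iff_prime_squarefree] at h
  push Not at h
  obtain ⟨p, hp, k, hk⟩ := h
  have hk0 : 0 < k := Nat.pos_of_ne_zero (by rintro rfl; simp at hk; omega)
  refine ⟨p * k, p, Nat.mul_pos hp.pos hk0, hp.one_lt, by rw [hk]; ring, fun d hd hdr => ?_⟩
  exact (hd.dvd_pow_iff_dvd two_ne_zero).1 (hdr.trans ⟨k, by rw [hk]; ring⟩)

theorem exists_eq_mul_of_nsmul_eq_mul {q F H : ℕ[X]} (hq : q.Monic) {p : ℕ} (hp : 0 < p)
    (h : p • F = q * H) : ∃ G, F = q * G := by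
  let φ := Nat.castRingHom ℤ
  have hφ : Function.Injective (Polynomial.map φ) := map_injective φ Nat.cast_injective
  have hq' : (q.map φ).Monic := hq.map φ
  have hZ : (p : ℤ) • F.map φ = q.map φ * H.map φ := by
    rw [← Polynomial.map_mul, ← h]
    simp
  have hd : q.map φ ∣ F.map φ := by
    rw [← modByMonic_eq_zero_iff_dvd hq']
    have := (modByMonic_eq_zero_iff_dvd hq').2 ⟨_, hZ⟩
    rw [smul_modByMonic] at this
    exact (smul_eq_zero.1 this).resolve_left (by exact_mod_cast hp.ne')
  obtain ⟨G, hG⟩ := hd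
  have hGH : (p : ℤ) • G = H.map φ := by
    apply mul_left_cancel₀ hq'.ne_zero
    rw [← hZ, hG, mul_smul_comm]
  have hG0 (k : ℕ) : 0 ≤ G.coeff k := by
    have := congrArg (coeff · k) hGH
    simp only [coeff_smul, coeff_map, smul_eq_mul] at this
    have hH : (0 : ℤ) ≤ φ (H.coeff k) := Int.natCast_nonneg _
    rw [← this] at hH
    exact nonneg_of_mul_nonneg_right hH (by exact_mod_cast hp)
  have hlift : G ∈ lifts φ := by
    rw [lifts_iff_coeff_lifts]
    exact fun k => ⟨(G.coeff k).toNat, Int.toNat_of_nonneg (hG0 k)⟩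
  obtain ⟨G', rfl⟩ := (mem_lifts G).1 hlift
  exact ⟨G', hφ (by rw [hG, Polynomial.map_mul])⟩

theorem exists_subsetPoly_eq_sq_mul {r : ℕ} (hr : 0 < r) (h : ¬ Squarefree r) :
    ∃ G : ℕ[X], subsetPoly (range r) r = (1 + X) ^ 2 * G := by
  obtain ⟨m, p, hm, hp, hrm, hd⟩ := exists_squarefree_dvd_of_not_squarefree hr h
  have hmr : m < r := by rw [hrm]; exact lt_mul_of_one_lt_right hm hp
  have hmono : ((1 + X) ^ 2 : ℕ[X]).Monic := by
    rw [add_comm, ← C_1]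
    exact (monic_X_add_C 1).pow 2
  refine exists_eq_mul_of_nsmul_eq_mul hmono (p := p) (by omega)
    (H := subsetPoly (((range r).erase 0).erase m) m) ?_
  rw [← subsetPoly_range_eq_sq_mul hm hmr]
  apply map_injective (Nat.castRingHom ℂ) Nat.cast_injective
  apply smul_right_injective _ hm.ne'
  have hmr' : m ∣ r := ⟨p, hrm⟩
  simp only
  rw [nsmul_map_subsetPoly_range hr hmr', Polynomial.map_smul, eq_natCast, Nat.cast_smul_eq_nsmul,
    smul_smul, ← hrm, nsmul_map_subsetPoly_range hr dvd_rfl]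
  refine (sum_subset (Nat.divisors_subset_of_dvd hr.ne' hmr') fun d hdr hdm => ?_).symm
  rw [ArithmeticFunction.moebius_eq_zero_of_not_squarefree, Int.cast_zero, C_0, zero_mul]
  intro hsq
  exact hdm (Nat.mem_divisors.2 ⟨hd d hsq (Nat.dvd_of_mem_divisors hdr), hm.ne'⟩)

end HookNumbers

section GeneratingFunction

open Polynomial

theorem PowerSeries.coeff_mk_one_pow_succ {R : Type*} [CommSemiring R] (d n : ℕ) :
    PowerSeries.coeff n ((PowerSeries.mk 1 : PowerSeries R) ^ (d + 1)) = ((d + n).choose d : R) := by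
  induction d generalizing n with
  | zero => simp
  | succ d ih =>
    rw [pow_succ', PowerSeries.coeff_mul]
    simp_rw [ih, PowerSeries.coeff_mk, Pi.one_apply, one_mul]
    norm_cast
    rw [Finset.sum_antidiagonal_choose_add, add_right_comm]

/-- The generating series, in `ℕ[x]⟦y⟧`, of the symmetric powers (for `j` even) or of the exterior
powers (for `j` odd) of a line of degree `j`: it is `1 / (1 - x ^ j y)` or `1 + x ^ j y`. -/
noncomputable def lineSeries (j : ℕ) : PowerSeries ℕ[X] :=
  if j % 2 = 0 then PowerSeries.mk fun k => X ^ (j * k)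
  else 1 + PowerSeries.C (X ^ j) * PowerSeries.X

theorem coeff_lineSeries_pow (j n k : ℕ) :
    PowerSeries.coeff k (lineSeries j ^ n) =
      C (if 0 < k then (n + (k - 1) * (if j % 2 = 0 then 1 else 0)).choose k else 1) *
        X ^ (j * k) := by
  rw [lineSeries]
  split_ifs with hj hk hk
  · have h : (PowerSeries.mk fun k => X ^ (j * k) : PowerSeries ℕ[X]) =
        PowerSeries.rescale (X ^ j) (PowerSeries.mk 1) := by
      ext1 k
      simp [pow_mul]
    rw [h, ← map_pow, PowerSeries.coeff_rescale, ← pow_mul, mul_comm]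
    congr 1
    cases n with
    | zero =>
      rw [pow_zero, PowerSeries.coeff_one, if_neg hk.ne', Nat.choose_eq_zero_of_lt (by omega), C_0]
    | succ n =>
      rw [PowerSeries.coeff_mk_one_pow_succ, Nat.choose_symm_add,
        show n + 1 + (k - 1) * 1 = n + k by omega]
      simp
  · obtain rfl : k = 0 := by omega
    simp
  · have h : (1 + PowerSeries.C (X ^ j) * PowerSeries.X : PowerSeries ℕ[X]) =
        PowerSeries.rescale (X ^ j) (((1 + X : ℕ[X][X]) : ℕ[X][X]) : PowerSeries ℕ[X]) := by
      rw [Polynomial.coe_add, Polynomial.coe_one, Polynomial.coe_X, map_add, map_one]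
      congr 1
      ext1 i
      rw [PowerSeries.coeff_C_mul, PowerSeries.coeff_rescale, PowerSeries.coeff_X]
      split_ifs with hi
      · rw [hi, pow_one]
      · simp
    rw [h, ← map_pow, PowerSeries.coeff_rescale, ← pow_mul, mul_comm, ← Polynomial.coe_pow,
      Polynomial.coeff_coe, Polynomial.coeff_one_add_X_pow]
    simp
  · obtain rfl : k = 0 := by omega
    simp

theorem lineSeries_succ_mul (j : ℕ) :
    ∃ B, lineSeries j * lineSeries (j + 1) * (lineSeries (j + 1) * lineSeries (j + 1 + 1)) =
      1 + PowerSeries.C ((1 + X) ^ 2) * B := by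
  set a : PowerSeries ℕ[X] := PowerSeries.C (X ^ j) * PowerSeries.X with ha
  set x : PowerSeries ℕ[X] := PowerSeries.C X with hx
  have hC : PowerSeries.C ((1 + X : ℕ[X]) ^ 2) = (1 + x) ^ 2 := by simp [hx]
  have hodd (i : ℕ) (hi : (j + i) % 2 ≠ 0) : lineSeries (j + i) = 1 + x ^ i * a := by
    rw [lineSeries, if_neg hi, ha, hx, pow_add, map_mul, map_pow _ X i]
    ring
  have heven (i : ℕ) (hi : (j + i) % 2 = 0) :
      lineSeries (j + i) = 1 + x ^ i * a * lineSeries (j + i) := by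
    have h : x ^ i * a * lineSeries (j + i) =
        PowerSeries.X * (PowerSeries.C (X ^ (j + i)) * lineSeries (j + i)) := by
      rw [ha, hx, pow_add, map_mul, map_pow _ X i]
      ring
    rw [h]
    ext1 k
    cases k with
    | zero => simp [lineSeries, if_pos hi]
    | succ k =>
      rw [map_add, PowerSeries.coeff_succ_X_mul, PowerSeries.coeff_C_mul, lineSeries, if_pos hi,
        PowerSeries.coeff_mk, PowerSeries.coeff_mk, PowerSeries.coeff_one, if_neg k.succ_ne_zero]
      ring
  rw [hC]
  rcases Nat.mod_two_eq_zero_or_one j with hj | hj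
  · have h0 := heven 0 (by omega)
    have h1 := hodd 1 (by omega)
    have h2 := heven 2 (by omega)
    rw [add_zero, pow_zero, one_mul] at h0
    rw [pow_one] at h1
    rw [add_assoc j 1 1, h1]
    set g := lineSeries j
    set h := lineSeries (j + 2)
    refine ⟨a * g * h, ?_⟩
    have e1 : g * h = 1 + a * g + x ^ 2 * a * h + x ^ 2 * a ^ 2 * (g * h) := by
      nth_rewrite 1 [h0, h2]
      ring
    have e2 : a * (g * h) = a * g + x ^ 2 * a ^ 2 * (g * h) := by
      nth_rewrite 1 [h2]
      ring
    have e3 : x ^ 2 * a * (g * h) = x ^ 2 * a * h + x ^ 2 * a ^ 2 * (g * h) := by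
      nth_rewrite 1 [h0]
      ring
    calc g * (1 + x * a) * ((1 + x * a) * h)
        = g * h + 2 * x * a * (g * h) + x ^ 2 * a ^ 2 * (g * h) := by ring
      _ = 1 + (a * g + x ^ 2 * a ^ 2 * (g * h)) + (x ^ 2 * a * h + x ^ 2 * a ^ 2 * (g * h))
          + 2 * x * a * (g * h) := by nth_rewrite 1 [e1]; ring
      _ = 1 + (1 + x) ^ 2 * (a * g * h) := by rw [← e2, ← e3]; ring
  · have h0 := hodd 0 (by omega)
    have h1 := heven 1 (by omega)
    have h2 := hodd 2 (by omega)
    rw [add_zero, pow_zero, one_mul] at h0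
    rw [pow_one] at h1
    rw [add_assoc j 1 1, h0, h2]
    set g := lineSeries (j + 1)
    refine ⟨a * g ^ 2, ?_⟩
    have e1 : g ^ 2 = 1 + 2 * (x * a * g) + x ^ 2 * a ^ 2 * g ^ 2 := by
      nth_rewrite 1 [h1]
      ring
    have e2 : x * a * g ^ 2 = x * a * g + x ^ 2 * a ^ 2 * g ^ 2 := by
      rw [sq g]
      nth_rewrite 1 [h1]
      ring
    calc (1 + a) * g * (g * (1 + x ^ 2 * a))
        = g ^ 2 + (a + x ^ 2 * a) * g ^ 2 + x ^ 2 * a ^ 2 * g ^ 2 := by ring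
      _ = 1 + 2 * (x * a * g + x ^ 2 * a ^ 2 * g ^ 2) + (a + x ^ 2 * a) * g ^ 2 := by
          nth_rewrite 1 [e1]; ring
      _ = 1 + (1 + x) ^ 2 * (a * g ^ 2) := by rw [← e2]; ring

theorem prod_pow_coeff_one_add_X_mul {M : Type*} [CommMonoid M] (u : ℕ → M) (H : ℕ[X]) {n : ℕ}
    (hH : H.natDegree < n) :
    ∏ j ∈ range (n + 1), u j ^ ((1 + X) * H).coeff j =
      ∏ j ∈ range n, (u j * u (j + 1)) ^ H.coeff j := by
  have h : ∏ j ∈ range (n + 1), u j ^ (X * H).coeff j = ∏ j ∈ range n, u (j + 1) ^ H.coeff j := by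
    rw [prod_range_succ']
    simp
  simp only [add_mul, one_mul, coeff_add, pow_add, prod_mul_distrib, mul_pow, h]
  rw [prod_range_succ, coeff_eq_zero_of_natDegree_lt hH, pow_zero, mul_one]

theorem prod_lineSeries_eq_one_add (G : ℕ[X]) {n : ℕ} (hG : G.natDegree < n) :
    ∃ B, ∏ j ∈ range (n + 1 + 1), lineSeries j ^ ((1 + X) ^ 2 * G).coeff j =
      1 + PowerSeries.C ((1 + X) ^ 2) * B := by
  have hdeg : ((1 + X) * G).natDegree < n + 1 := by
    refine natDegree_mul_le.trans_lt ?_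
    have : (1 + X : ℕ[X]).natDegree ≤ 1 := by compute_degree
    omega
  rw [sq, mul_assoc, prod_pow_coeff_one_add_X_mul _ _ hdeg, prod_pow_coeff_one_add_X_mul _ _ hG]
  have hmul (c a b : PowerSeries ℕ[X]) (ha : ∃ B, a = 1 + c * B) (hb : ∃ B, b = 1 + c * B) :
      ∃ B, a * b = 1 + c * B := by
    obtain ⟨A, rfl⟩ := ha
    obtain ⟨B, rfl⟩ := hb
    exact ⟨A + B + c * A * B, by ring⟩
  have hone (c : PowerSeries ℕ[X]) : ∃ B, 1 = 1 + c * B := ⟨0, by simp⟩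
  refine prod_induction _ (fun a => ∃ B, a = 1 + _ * B) (hmul _) (hone _) fun j _ => ?_
  generalize G.coeff j = k
  induction k with
  | zero =>
    rw [pow_zero]
    exact hone _
  | succ k ih =>
    rw [pow_succ]
    refine hmul _ _ _ ih ?_
    rw [← sq]
    exact lineSeries_succ_mul j

theorem kmult_eq_count {r s : ℕ} (γ : Sym (Fin (r + 1)) s) (j : Fin (r + 1)) :
    kmult γ j = (γ : Multiset (Fin (r + 1))).count j :=
  Multiset.count_map_eq_count' _ _ Fin.val_injective _

theorem sum_map_val_eq_sum_kmult {r s : ℕ} (γ : Sym (Fin (r + 1)) s) :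
    ((γ : Multiset (Fin (r + 1))).map Fin.val).sum = ∑ j : Fin (r + 1), j * kmult γ j := by
  rw [Finset.sum_multiset_map_count]
  simp only [kmult_eq_count, smul_eq_mul, mul_comm]
  exact sum_subset (subset_univ _) fun j _ hj => by simp_all

/-- The generating polynomial `∑ i, e r s i * x ^ i`. -/
noncomputable def ePoly (r s : ℕ) : ℕ[X] := ∑ i ∈ range (r * s + 1), C (e r s i) * X ^ i

theorem ePoly_eq_coeff (r s : ℕ) :
    ePoly r s =
      PowerSeries.coeff s (∏ j ∈ range (r + 1), lineSeries j ^ fNat r j) := by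
  rw [prod_range, PowerSeries.coeff_prod]
  simp only [coeff_lineSeries_pow, prod_mul_distrib, prod_pow_eq_pow_sum, ← map_prod C]
  have hmaps : ∀ γ ∈ (univ : Finset (Sym (Fin (r + 1)) s)),
      ((γ : Multiset (Fin (r + 1))).map Fin.val).sum ∈ range (r * s + 1) := by
    intro γ _
    rw [mem_range, Nat.lt_succ_iff]
    refine (Multiset.sum_le_card_nsmul _ r ?_).trans ?_
    · intro x hx
      obtain ⟨y, -, rfl⟩ := Multiset.mem_map.1 hx
      exact Nat.lt_succ_iff.1 y.2
    · simp [mul_comm]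
  simp only [ePoly, e, map_sum C, sum_mul]
  have hfib (w : Sym (Fin (r + 1)) s → ℕ[X]) (i : ℕ) :
      ∑ γ ∈ Pset r s i,
        w γ * X ^ i =
      ∑ γ ∈ Pset r s i,
        w γ * X ^ ∑ j : Fin (r + 1), (j : ℕ) * kmult γ j :=
    sum_congr rfl fun γ hγ => by rw [← sum_map_val_eq_sum_kmult, (mem_filter.1 hγ).2]
  rw [sum_congr rfl fun i _ => hfib _ i]
  simp only [Pset]
  rw [sum_fiberwise_of_maps_to hmaps]
  refine sum_bij (fun γ _ => Multiset.toFinsupp (γ : Multiset (Fin (r + 1)))) ?_ ?_ ?_ ?_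
  · intro γ _
    have h := Multiset.toFinsupp_sum_eq (γ : Multiset (Fin (r + 1)))
    rw [Finsupp.sum_fintype _ _ fun _ => rfl] at h
    exact mem_finsuppAntidiag.2 ⟨h.trans γ.2, subset_univ _⟩
  · intro γ _ γ' _ h
    exact Sym.coe_injective (Multiset.toFinsupp.injective h)
  · intro l hl
    refine ⟨⟨Finsupp.toMultiset l, ?_⟩, mem_univ _, Finsupp.toMultiset_toFinsupp l⟩
    rw [Finsupp.card_toMultiset, Finsupp.sum_fintype _ _ fun _ => rfl]
    exact (mem_finsuppAntidiag.1 hl).1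
  · intro γ _
    rw [prod_range]
    simp only [kmult_eq_count, Multiset.toFinsupp_apply]
    congr!

theorem ePoly_one_eq_subsetPoly {r : ℕ} (hr : 0 < r) : ePoly r 1 = subsetPoly (range r) r := by
  have h (t : Finset ℕ) : PowerSeries.coeff 0 (∏ j ∈ t, lineSeries j ^ fNat r j) = 1 ∧
      PowerSeries.coeff 1 (∏ j ∈ t, lineSeries j ^ fNat r j) = ∑ j ∈ t, C (fNat r j) * X ^ j := by
    induction t using Finset.induction_on with
    | empty => simp [PowerSeries.coeff_one]
    | insert i t hi ih =>
      rw [prod_insert hi, sum_insert hi]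
      constructor
      · rw [PowerSeries.coeff_zero_eq_constantCoeff_apply, map_mul,
          ← PowerSeries.coeff_zero_eq_constantCoeff_apply,
          ← PowerSeries.coeff_zero_eq_constantCoeff_apply, ih.1, coeff_lineSeries_pow]
        simp
      · rw [PowerSeries.coeff_one_mul, ih.2]
        simp [← PowerSeries.coeff_zero_eq_constantCoeff_apply, coeff_lineSeries_pow]
  rw [ePoly_eq_coeff, (h _).2, subsetPoly_range_eq_sum hr]

theorem exists_ePoly_eq_sq_mul {r s : ℕ} (hr : 0 < r) (h : ¬ Squarefree r) (hs : 1 ≤ s) :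
    ∃ Q : ℕ[X], ePoly r s = (1 + X) ^ 2 * Q := by
  obtain ⟨G, hG⟩ := exists_subsetPoly_eq_sq_mul hr h
  have hlt : G.natDegree < max r (G.natDegree + 1) := by omega
  obtain ⟨B, hB⟩ := prod_lineSeries_eq_one_add G hlt
  refine ⟨PowerSeries.coeff s B, ?_⟩
  have hF (j : ℕ) : fNat r j = ((1 + X) ^ 2 * G).coeff j := by
    rw [← hG, coeff_subsetPoly_eq_fNat hr]
  rw [ePoly_eq_coeff, prod_subset
    (range_mono (by omega : r + 1 ≤ max r (G.natDegree + 1) + 1 + 1))]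
  · simp only [hF]
    rw [hB, map_add, PowerSeries.coeff_one, if_neg (by omega), zero_add, PowerSeries.coeff_C_mul]
  · intro j _ hj
    rw [← coeff_subsetPoly_eq_fNat hr, coeff_eq_zero_of_natDegree_lt, pow_zero]
    exact (natDegree_subsetPoly_range_le r r).trans_lt (by simpa using hj)

theorem one_add_X_mul_sum_mm (r s n : ℕ) :
    (1 + X) * ∑ i ∈ range n, C (mm r s i) * X ^ i + C (mm r s n) * X ^ n =
      ∑ i ∈ range (n + 1), C (e r s i : ℚ) * X ^ i := by
  induction n with
  | zero => simp [mm]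
  | succ n ih =>
    have hm : mm r s (n + 1) = e r s (n + 1) - mm r s n := by
      rw [mm, sum_range_succ, mm, Nat.sub_self, pow_zero, one_mul, add_comm, sub_eq_add_neg,
        ← sum_neg_distrib]
      congr 1
      refine sum_congr rfl fun k hk => ?_
      rw [Nat.succ_sub (by simpa [Nat.lt_succ_iff] using hk), pow_succ]
      ring
    rw [sum_range_succ _ (n + 1), ← ih, sum_range_succ, hm, C_sub]
    ring

theorem one_add_X_mul_N {r s : ℕ}
    (h : ((ePoly r s).map (Nat.castRingHom ℚ)).eval (-1) = 0) :
    (1 + X) * N r s = (ePoly r s).map (Nat.castRingHom ℚ) := by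
  have hE : (ePoly r s).map (Nat.castRingHom ℚ) =
      ∑ i ∈ range (r * s + 1), C (e r s i : ℚ) * X ^ i := by
    simp [ePoly, Polynomial.map_sum]
  have hN := one_add_X_mul_sum_mm r s (r * s)
  rw [← hE] at hN
  have h0 := congrArg (eval (-1)) hN
  rw [h] at h0
  have hm : mm r s (r * s) = 0 := by simpa using h0
  rw [← hN, hm, N]
  simp

end GeneratingFunction

open Polynomial in
/-- Theorem 1.6: (i) `(1+x) ∣ N_{r,1}` iff (ii) `(1+x) ∣ N_{r,s}` for all `s ≥ 1`
iff (iii) `r` is not squarefree; moreover, in that case each quotient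
`N_{r,s}(x)/(1+x)` has nonnegative integer coefficients. -/
theorem stmt13 (r : ℕ) (hr : 1 ≤ r) :
    (((1 + X) ∣ N r 1) ↔ ¬ Squarefree r) ∧
    ((∀ s, 1 ≤ s → (1 + X) ∣ N r s) ↔ ¬ Squarefree r) ∧
    (¬ Squarefree r → ∀ s, 1 ≤ s → ∃ Q : Polynomial ℚ,
      N r s = (1 + X) * Q ∧ ∀ k, ∃ c : ℕ, Q.coeff k = (c : ℚ)) := by
  have hquot : ¬ Squarefree r → ∀ s, 1 ≤ s → ∃ Q : ℚ[X],
      N r s = (1 + X) * Q ∧ ∀ k, ∃ c : ℕ, Q.coeff k = (c : ℚ) := by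
    intro h s hs
    obtain ⟨Q, hQ⟩ := exists_ePoly_eq_sq_mul hr h hs
    refine ⟨Q.map (Nat.castRingHom ℚ), ?_, fun k => ⟨Q.coeff k, by simp⟩⟩
    have hne : (1 + X : ℚ[X]) ≠ 0 := by
      rw [add_comm, ← C_1]
      exact X_add_C_ne_zero 1
    apply mul_left_cancel₀ hne
    rw [one_add_X_mul_N (by simp [hQ]), hQ]
    simp [sq, mul_assoc]
  have hone : (1 + X) ∣ N r 1 → ¬ Squarefree r := by
    rintro ⟨Q, hQ⟩
    apply not_squarefree_of_sq_dvd_subsetPoly hr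
    have hmap : (subsetPoly (range r) r).map (Nat.castRingHom ℂ) =
        ((subsetPoly (range r) r).map (Nat.castRingHom ℚ)).map (algebraMap ℚ ℂ) := by
      rw [Polynomial.map_map]
      congr 1
    have h0 : ((ePoly r 1).map (Nat.castRingHom ℚ)).eval (-1) = 0 := by
      have := eval_neg_one_subsetPoly_range hr
      rw [hmap, ← map_one (algebraMap ℚ ℂ), ← map_neg, eval_map_apply, map_eq_zero] at this
      rwa [ePoly_one_eq_subsetPoly hr]
    have hN := one_add_X_mul_N h0
    rw [hmap, ← ePoly_one_eq_subsetPoly hr, ← hN, hQ]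
    exact ⟨Q.map (algebraMap ℚ ℂ), by simp [sq, mul_assoc]⟩
  have hdvd : ¬ Squarefree r → ∀ s, 1 ≤ s → (1 + X) ∣ N r s := fun h s hs =>
    let ⟨Q, hQ, _⟩ := hquot h s hs
    ⟨Q, hQ⟩
  exact ⟨⟨hone, fun h => hdvd h 1 le_rfl⟩, ⟨fun h => hone (h 1 le_rfl), hdvd⟩, hquot⟩
end
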